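/- arXiv:1003.3729 — 7 statements merged into one kernel-verified Lean document; each statement's English description precedes it below -/
import Mathlib

section
/- For every integer n ≥ 2, one has the identity G_{n,0} = q^{n−1} + q^{n−3} + ⋯ + q^{3−n} + q^{1−n}, i.e. G_{n,0} = Σ_{i=1}^{n} q^{n−2i+1}, as elements of F. -/
open scoped BigOperators

noncomputable section

abbrev Kq : Type := RatFunc ℚ
abbrev Pn (n : ℕ) : Type := MvPolynomial (Fin n) Kq
abbrev Fn (n : ℕ) : Type := FractionRing (Pn n)

noncomputable def qq (n : ℕ) : Fn n :=
  algebraMap (Pn n) (Fn n) (MvPolynomial.C RatFunc.X)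

noncomputable def L (n : ℕ) (i : Fin n) : Fn n :=
  algebraMap (Pn n) (Fn n) (MvPolynomial.X i)

noncomputable def P (n : ℕ) (S : Finset (Fin n)) (i : Fin n) : Fn n :=
  ∏ j ∈ S.erase i, (qq n * L n i - (qq n)⁻¹ * L n j) / (L n i - L n j)

noncomputable def G (n : ℕ) (S : Finset (Fin n)) (k : ℕ) : Fn n :=
  ∑ i ∈ S, (L n i) ^ k * P n S i

def pset (n m : ℕ) : Finset (Fin n) := Finset.univ.filter fun j => (j : ℕ) < m

open Polynomial in
/-- Lagrange interpolation of `∏ j ∈ s, (a X - b v j)` at the nodes `v i`, `i ∈ s`, and `0`. -/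
theorem sub_mul_sum_prod_erase_div {ι K : Type*} [DecidableEq ι] [Field K] (s : Finset ι)
    (v : ι → K) (hv : Set.InjOn v s) (h0 : ∀ i ∈ s, v i ≠ 0) (a b : K) :
    (a - b) * ∑ i ∈ s, ∏ j ∈ s.erase i, (a * v i - b * v j) / (v i - v j) =
      a ^ s.card - b ^ s.card := by
  let w : Option ι → K := fun o => o.elim 0 v
  let p : K[X] := ∏ j ∈ s, (C a * X - C (b * v j))
  have hle : ∀ j ∈ s, (C a * X - C (b * v j)).natDegree ≤ 1 := fun j _ => by compute_degree
  have hdeg : p.natDegree ≤ s.card := by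
    simpa [p] using (natDegree_prod_le s _).trans (Finset.sum_le_sum hle)
  have hcoeff : p.coeff s.card = a ^ s.card := by
    have h := coeff_prod_of_natDegree_le s (fun j => C a * X - C (b * v j)) 1 hle
    simpa [p, coeff_C] using h
  have heval (x : K) : p.eval x = ∏ j ∈ s, (a * x - b * v j) := by
    simp [p, eval_prod]
  have hw : Set.InjOn w (Finset.insertNone s) := by
    rintro (_ | i) hi (_ | j) hj h
    · rfl
    · exact absurd h.symm (h0 j (by simpa using hj))
    · exact absurd h (h0 i (by simpa using hi))
    · exact congrArg some (hv (by simpa using hi) (by simpa using hj) h)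
  have hnone : (Finset.insertNone s).erase none = s.map Function.Embedding.some := by
    ext (_ | i) <;> simp
  have hsome (i : ι) : (Finset.insertNone s).erase (some i) = Finset.insertNone (s.erase i) := by
    ext (_ | j) <;> simp
  have key := Lagrange.coeff_eq_sum hw (P := p) (by
    rw [Finset.card_insertNone]
    exact degree_le_natDegree.trans_lt (by exact_mod_cast Nat.lt_succ_of_le hdeg))
  rw [Finset.card_insertNone, Nat.add_sub_cancel, hcoeff, Finset.sum_insertNone, hnone,
    Finset.prod_map] at key
  have hzero : p.eval (w none) / ∏ j ∈ s, (w none - w (Function.Embedding.some j)) =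
      b ^ s.card := by
    rw [heval, ← Finset.prod_div_distrib, ← Finset.prod_const]
    refine Finset.prod_congr rfl fun j hj => ?_
    have := h0 j hj
    simp [w, this, neg_div_neg_eq]
  have hnode : ∀ i ∈ s, p.eval (w (some i)) /
      ∏ j ∈ (Finset.insertNone s).erase (some i), (w (some i) - w j) =
      (a - b) * ∏ j ∈ s.erase i, (a * v i - b * v j) / (v i - v j) := by
    intro i hi
    have := h0 i hi
    rw [hsome, Finset.prod_insertNone, heval, ← Finset.mul_prod_erase s _ hi,
      Finset.prod_div_distrib]
    simp only [w, Option.elim, sub_zero]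
    rw [← sub_mul, mul_div_mul_comm, mul_div_cancel_right₀ _ this]
  rw [hzero, Finset.sum_congr rfl hnode, ← Finset.mul_sum] at key
  rw [key, add_sub_cancel_left]

theorem L_injective (n : ℕ) : Function.Injective (L n) :=
  (IsFractionRing.injective (Pn n) (Fn n)).comp (MvPolynomial.X_injective)

theorem L_ne_zero (n : ℕ) (i : Fin n) : L n i ≠ 0 :=
  (map_ne_zero_iff _ (IsFractionRing.injective (Pn n) (Fn n))).2 (MvPolynomial.X_ne_zero i)

theorem qq_ne_zero (n : ℕ) : qq n ≠ 0 :=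
  (map_ne_zero_iff _ (IsFractionRing.injective (Pn n) (Fn n))).2
    (MvPolynomial.C_ne_zero.2 RatFunc.X_ne_zero)

theorem qq_sq_ne_one (n : ℕ) : qq n ^ 2 ≠ 1 := by
  intro h
  have h1 : (RatFunc.X : Kq) ^ 2 = 1 := by
    apply MvPolynomial.C_injective (Fin n) Kq
    apply IsFractionRing.injective (Pn n) (Fn n)
    simpa only [map_pow, map_one, qq] using h
  have h2 : (Polynomial.X : Polynomial ℚ) ^ 2 = 1 := by
    apply RatFunc.algebraMap_injective ℚ
    simpa only [map_pow, map_one, RatFunc.algebraMap_X] using h1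
  simpa using congrArg (Polynomial.eval 0) h2

theorem sub_inv_mul_sum_zpow {K : Type*} [Field K] {q : K} (hq : q ≠ 0) (n : ℕ) :
    (q - q⁻¹) * ∑ i : Fin n, q ^ ((n : ℤ) - 2 * ((i : ℕ) + 1 : ℤ) + 1) = q ^ n - q⁻¹ ^ n := by
  rw [Fin.sum_univ_eq_sum_range (fun i : ℕ => q ^ ((n : ℤ) - 2 * ((i : ℤ) + 1) + 1)),
    ← neg_sub (q⁻¹ ^ n), ← geom_sum₂_mul, ← mul_neg, neg_sub, mul_comm]
  congr 1
  refine Finset.sum_congr rfl fun i hi => ?_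
  have hi' := Finset.mem_range.1 hi
  rw [inv_pow, ← zpow_natCast, ← zpow_natCast, ← zpow_neg, ← zpow_add₀ hq]
  congr 1
  lia

/-- For every integer `n ≥ 2`, `G_{n,0} = q^{n-1} + q^{n-3} + ⋯ + q^{1-n} = ∑_{i=1}^n q^{n-2i+1}`. -/
theorem stmt_0 (n : ℕ) (hn : 2 ≤ n) :
    G n Finset.univ 0 =
      ∑ i : Fin n, (qq n) ^ ((n : ℤ) - 2 * ((i : ℕ) + 1 : ℤ) + 1) := by
  have hq := qq_ne_zero n
  have hne : qq n - (qq n)⁻¹ ≠ 0 := fun h => qq_sq_ne_one n (by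
    rw [sq]
    nth_rewrite 2 [sub_eq_zero.1 h]
    exact mul_inv_cancel₀ hq)
  apply mul_left_cancel₀ hne
  rw [sub_inv_mul_sum_zpow hq]
  simpa [G, P] using sub_mul_sum_prod_erase_div Finset.univ (L n) (L_injective n).injOn
    (fun i _ => L_ne_zero n i) (qq n) (qq n)⁻¹
end
end

section
/- For every integer n ≥ 2, one has the identity G_{n,1} = q^{n−1}·(L_1 + L_2 + ⋯ + L_n) as elements of F. -/
open scoped BigOperators

noncomputable section

open Polynomial in
theorem sum_mul_prod_erase_div_eq {ι K : Type*} [DecidableEq ι] [Field K] {s : Finset ι}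
    (hs : s.Nonempty) {v : ι → K} (hv : Set.InjOn v s) {a b : K} (ha : a ≠ 0) (hab : a ≠ b) :
    ∑ i ∈ s, v i * ∏ j ∈ s.erase i, (a * v i - b * v j) / (v i - v j) =
      a ^ (s.card - 1) * ∑ i ∈ s, v i := by
  have hsub : a - b ≠ 0 := sub_ne_zero.mpr hab
  have hpos := hs.card_pos
  set p : K[X] := ∏ j ∈ s, (X - C (b / a * v j)) with hp
  set r : K[X] := ∏ j ∈ s, (X - C (v j)) with hr
  have hpm : p.Monic := monic_prod_of_monic _ _ fun _ _ => monic_X_sub_C _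
  have hrm : r.Monic := monic_prod_of_monic _ _ fun _ _ => monic_X_sub_C _
  have hpd : p.degree = s.card := by simp [hp, degree_prod, -map_mul]
  have hrd : r.degree = s.card := by simp [hr, degree_prod]
  have hdeg : (p - r).degree < s.card := by
    rw [← hpd]
    exact degree_sub_lt_left (hpd.trans hrd.symm) hpm.ne_zero
      (hpm.leadingCoeff.trans hrm.leadingCoeff.symm)
  have key := Lagrange.coeff_eq_sum hv hdeg
  rw [coeff_sub, hp, hr, prod_X_sub_C_coeff_card_pred _ _ hpos,
    prod_X_sub_C_coeff_card_pred _ _ hpos, ← Finset.mul_sum, ← hp, ← hr] at key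
  have heval : ∀ i ∈ s, a ^ s.card * ((p - r).eval (v i) / ∏ j ∈ s.erase i, (v i - v j)) =
      (a - b) * (v i * ∏ j ∈ s.erase i, (a * v i - b * v j) / (v i - v j)) := by
    intro i hi
    have hr0 : r.eval (v i) = 0 := by
      rw [hr, eval_prod]
      exact Finset.prod_eq_zero hi (by simp)
    have hpe : a ^ s.card * p.eval (v i) = ∏ j ∈ s, (a * v i - b * v j) := by
      rw [hp, eval_prod, ← Finset.prod_const, ← Finset.prod_mul_distrib]
      refine Finset.prod_congr rfl fun j _ => ?_
      simp only [eval_sub, eval_X, eval_C]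
      field_simp
    rw [eval_sub, hr0, sub_zero, ← mul_div_assoc, hpe, ← Finset.mul_prod_erase s _ hi,
      Finset.prod_div_distrib]
    ring
  refine mul_left_cancel₀ hsub ?_
  rw [Finset.mul_sum, ← Finset.sum_congr rfl heval, ← Finset.mul_sum, ← key]
  obtain ⟨m, hm⟩ := Nat.exists_eq_add_of_lt hpos
  rw [hm]
  simp only [zero_add, Nat.add_sub_cancel, pow_succ]
  field_simp
  ring

theorem qq_ne_qq_inv (n : ℕ) : qq n ≠ (qq n)⁻¹ := by
  intro h
  have h2 : qq n ^ 2 = 1 := by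
    rw [sq]
    nth_rewrite 2 [h]
    exact mul_inv_cancel₀ (qq_ne_zero n)
  have h3 : (RatFunc.X : Kq) ^ 2 = 1 := by
    apply MvPolynomial.C_injective (Fin n) Kq
    apply IsFractionRing.injective (Pn n) (Fn n)
    simpa [qq] using h2
  have h4 : (Polynomial.X : Polynomial ℚ) ^ 2 = 1 := by
    apply RatFunc.algebraMap_injective ℚ
    simpa using h3
  simpa using congrArg (Polynomial.eval 0) h4

/-- For every integer `n ≥ 2`, `G_{n,1} = q^{n-1}·(L_1 + ⋯ + L_n)`. -/
theorem stmt_1 (n : ℕ) (hn : 2 ≤ n) :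
    G n Finset.univ 1 = (qq n) ^ (n - 1) * ∑ i : Fin n, L n i := by
  have : Nonempty (Fin n) := ⟨⟨0, by lia⟩⟩
  simpa [G, P] using sum_mul_prod_erase_div_eq (Finset.univ_nonempty (α := Fin n))
    (L_injective n).injOn (qq_ne_zero n) (qq_ne_qq_inv n)
end
end

section
/- For all integers n ≥ 2 and k ≥ 1, the following recurrence holds in F: G_{n,k} = L_n·G_{n,k−1} + q·G_{n−1,k} − q^{−1}·L_n·G_{n−1,k−1}. -/
open scoped BigOperators

noncomputable section

theorem sub_mul_P_insert {n : ℕ} {S : Finset (Fin n)} {a i : Fin n} (ha : a ∉ S) (hi : i ∈ S) :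
    (L n i - L n a) * P n (insert a S) i = (qq n * L n i - (qq n)⁻¹ * L n a) * P n S i := by
  have hia : i ≠ a := fun h => ha (h ▸ hi)
  have hL : L n i - L n a ≠ 0 := sub_ne_zero.mpr ((L_injective n).ne hia)
  rw [P, P, Finset.erase_insert_of_ne hia.symm,
    Finset.prod_insert fun h => ha (Finset.mem_of_mem_erase h), ← mul_assoc, mul_div_cancel₀ _ hL]

theorem G_insert_succ {n : ℕ} {S : Finset (Fin n)} {a : Fin n} (ha : a ∉ S) (k : ℕ) :
    G n (insert a S) (k + 1) =
      L n a * G n (insert a S) k + qq n * G n S (k + 1) - (qq n)⁻¹ * L n a * G n S k := by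
  have h : ∑ i ∈ S, L n i ^ k * ((L n i - L n a) * P n (insert a S) i) =
      ∑ i ∈ S, L n i ^ k * ((qq n * L n i - (qq n)⁻¹ * L n a) * P n S i) :=
    Finset.sum_congr rfl fun i hi => by rw [sub_mul_P_insert ha hi]
  have hl : ∑ i ∈ S, L n i ^ k * ((L n i - L n a) * P n (insert a S) i) =
      ∑ i ∈ S, L n i ^ (k + 1) * P n (insert a S) i -
        L n a * ∑ i ∈ S, L n i ^ k * P n (insert a S) i := by
    rw [Finset.mul_sum, ← Finset.sum_sub_distrib]
    exact Finset.sum_congr rfl fun i _ => by ring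
  have hr : ∑ i ∈ S, L n i ^ k * ((qq n * L n i - (qq n)⁻¹ * L n a) * P n S i) =
      qq n * G n S (k + 1) - (qq n)⁻¹ * L n a * G n S k := by
    rw [G, G, Finset.mul_sum, Finset.mul_sum, ← Finset.sum_sub_distrib]
    exact Finset.sum_congr rfl fun i _ => by ring
  rw [G, G, Finset.sum_insert ha, Finset.sum_insert ha]
  linear_combination h - hl + hr

theorem insert_last_pset {n : ℕ} (hn : n - 1 < n) :
    insert ⟨n - 1, hn⟩ (pset n (n - 1)) = Finset.univ := by
  ext j
  simp only [pset, Finset.mem_insert, Finset.mem_filter, Finset.mem_univ, true_and, Fin.ext_iff,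
    iff_true]
  omega

/-- For `n ≥ 2`, `k ≥ 1`:
`G_{n,k} = L_n·G_{n,k-1} + q·G_{n-1,k} - q⁻¹·L_n·G_{n-1,k-1}`. -/
theorem stmt_2 (n k : ℕ) (hn : 2 ≤ n) (hk : 1 ≤ k) :
    G n Finset.univ k =
      L n ⟨n - 1, by omega⟩ * G n Finset.univ (k - 1)
        + qq n * G n (pset n (n - 1)) k
        - (qq n)⁻¹ * L n ⟨n - 1, by omega⟩ * G n (pset n (n - 1)) (k - 1) := by
  obtain ⟨k, rfl⟩ : ∃ m, k = m + 1 := ⟨k - 1, by omega⟩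
  have hlast : (⟨n - 1, by omega⟩ : Fin n) ∉ pset n (n - 1) := by simp [pset]
  have h := G_insert_succ hlast k
  rwa [insert_last_pset] at h
end
end

section
/- For all integers n ≥ 2 and k ≥ 1, the following recurrence holds in F: G_{n,k} = q·G_{n−1,k} + (q − q^{−1})·Σ_{i=0}^{k−1} L_n^{k−i}·G_{n−1,i} + q^{−(n−1)}·L_n^k. -/
open scoped BigOperators

noncomputable section

section Field

variable {ι F : Type*} [Field F] [DecidableEq ι]

open Polynomial in
/-- The interpolation of `∏ j ∈ s, (p * Y - r * x j)` at the nodes `0` and `x j`, `j ∈ s`. -/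
theorem prod_sub_eq_interpolate (s : Finset ι) (x : ι → F) (hinj : Set.InjOn x s)
    (hx : ∀ i ∈ s, x i ≠ 0) (p r y : F) :
    ∏ j ∈ s, (p * y - r * x j) =
      r ^ s.card * ∏ j ∈ s, (y - x j) +
        ∑ i ∈ s, (∏ j ∈ s.erase i, (p * x i - r * x j) / (x i - x j)) *
          ((p - r) * y * ∏ j ∈ s.erase i, (y - x j)) := by
  classical
  have hcard : (insert 0 (s.image x)).card = s.card + 1 := by
    rw [Finset.card_insert_of_notMem, Finset.card_image_of_injOn hinj]
    simpa using hx
  have hdeg (t : Finset ι) (f : ι → F[X]) (hf : ∀ i ∈ t, (f i).natDegree ≤ 1) :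
      (∏ i ∈ t, f i).natDegree ≤ t.card :=
    (natDegree_prod_le t f).trans (by simpa using Finset.sum_le_sum hf)
  have key : (∏ j ∈ s, (C p * X - C (r * x j)) : F[X]) =
      C (r ^ s.card) * ∏ j ∈ s, (X - C (x j)) +
        ∑ i ∈ s, C (∏ j ∈ s.erase i, (p * x i - r * x j) / (x i - x j)) *
          (C (p - r) * X * ∏ j ∈ s.erase i, (X - C (x j))) := by
    refine eq_of_degrees_lt_of_eval_finset_eq (insert 0 (s.image x)) ?_ ?_ ?_
    · rw [hcard]
      refine degree_le_natDegree.trans_lt (Nat.cast_lt.2 (Nat.lt_succ_of_le (hdeg _ _ ?_)))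
      intro i _
      compute_degree
    · rw [hcard]
      refine degree_le_natDegree.trans_lt (Nat.cast_lt.2 (Nat.lt_succ_of_le ?_))
      refine natDegree_add_le_of_degree_le ?_ (natDegree_sum_le_of_forall_le _ _ ?_)
      · refine (natDegree_C_mul_le _ _).trans (hdeg _ _ fun i _ => ?_)
        compute_degree
      · intro i hi
        refine (natDegree_C_mul_le _ _).trans ?_
        rw [mul_assoc]
        refine (natDegree_C_mul_le _ _).trans (natDegree_mul_le.trans ?_)
        have h := hdeg (s.erase i) (fun j => X - C (x j)) fun i _ => by compute_degree
        have h' := Finset.card_erase_add_one hi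
        have h'' : (X : F[X]).natDegree ≤ 1 := natDegree_X_le
        omega
    · intro z hz
      simp only [Finset.mem_insert, Finset.mem_image] at hz
      obtain rfl | ⟨i, hi, rfl⟩ := hz
      · simp [eval_prod, eval_finsetSum, ← mul_neg, Finset.prod_mul_distrib]
      · simp only [eval_prod, eval_finsetSum, eval_add, eval_mul, eval_sub, eval_C, eval_X]
        rw [Finset.prod_eq_zero (f := fun j => x i - x j) hi (sub_self _), mul_zero, zero_add,
          Finset.sum_eq_single_of_mem i hi]
        · rw [← Finset.mul_prod_erase s _ hi, Finset.prod_div_distrib]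
          have h : ∏ j ∈ s.erase i, (x i - x j) ≠ 0 := by
            refine Finset.prod_ne_zero_iff.2 fun j hj => sub_ne_zero.2 fun h => ?_
            exact Finset.ne_of_mem_erase hj (hinj (Finset.mem_of_mem_erase hj) hi h.symm)
          field_simp
        · intro j _ hji
          rw [Finset.prod_eq_zero (f := fun l => x i - x l)
            (Finset.mem_erase.2 ⟨hji.symm, hi⟩) (sub_self _), mul_zero, mul_zero]
  simpa [eval_prod, eval_finsetSum] using congrArg (eval y) key

theorem prod_div_sub_eq_partial_fractions (s : Finset ι) (x : ι → F) (hinj : Set.InjOn x s)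
    (hx : ∀ i ∈ s, x i ≠ 0) (p r y : F) (hy : ∀ i ∈ s, y ≠ x i) :
    ∏ j ∈ s, (p * y - r * x j) / (y - x j) =
      r ^ s.card + ∑ i ∈ s, (∏ j ∈ s.erase i, (p * x i - r * x j) / (x i - x j)) *
        ((p - r) * y / (y - x i)) := by
  have h : ∏ j ∈ s, (y - x j) ≠ 0 :=
    Finset.prod_ne_zero_iff.2 fun j hj => sub_ne_zero.2 (hy j hj)
  rw [Finset.prod_div_distrib, div_eq_iff h, prod_sub_eq_interpolate s x hinj hx, add_mul,
    Finset.sum_mul]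
  congr 1
  refine Finset.sum_congr rfl fun i hi => ?_
  have hi' := sub_ne_zero.2 (hy i hi)
  rw [← Finset.mul_prod_erase s _ hi]
  field_simp

theorem sum_insert_pow_mul_prod_div_sub (s : Finset ι) (a : ι) (ha : a ∉ s) (x : ι → F)
    (hinj : Function.Injective x) (hx : ∀ i ∈ s, x i ≠ 0) (p r : F) (k : ℕ) :
    ∑ i ∈ insert a s, x i ^ k *
        ∏ j ∈ (insert a s).erase i, (p * x i - r * x j) / (x i - x j) =
      p * ∑ i ∈ s, x i ^ k * ∏ j ∈ s.erase i, (p * x i - r * x j) / (x i - x j) +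
        (p - r) * ∑ l ∈ Finset.range k, x a ^ (k - l) *
          ∑ i ∈ s, x i ^ l * ∏ j ∈ s.erase i, (p * x i - r * x j) / (x i - x j) +
        r ^ s.card * x a ^ k := by
  have hne : ∀ i ∈ s, x a ≠ x i := fun i hi h => ha (hinj h ▸ hi)
  have hgeom : ∀ i ∈ s, ∑ l ∈ Finset.range k, x a ^ (k - l) * x i ^ l =
      x a * (x a ^ k - x i ^ k) / (x a - x i) := by
    intro i hi
    rw [eq_div_iff (sub_ne_zero.2 (hne i hi)), ← neg_sub (x i ^ k), ← geom_sum₂_mul,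
      ← neg_sub (x i), mul_neg, mul_neg, ← mul_assoc, Finset.mul_sum]
    congr 2
    refine Finset.sum_congr rfl fun l hl => ?_
    have hl := Finset.mem_range.1 hl
    rw [show k - l = k - 1 - l + 1 by omega]
    ring
  rw [Finset.sum_insert ha, Finset.erase_insert ha,
    prod_div_sub_eq_partial_fractions s x hinj.injOn hx p r (x a) hne]
  simp only [Finset.mul_sum (s := s)]
  rw [Finset.sum_comm]
  simp only [← mul_assoc, ← Finset.sum_mul]
  rw [mul_add, Finset.mul_sum, mul_comm _ (r ^ _), add_assoc, ← Finset.sum_add_distrib, add_comm,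
    Finset.mul_sum s _ (p - r), ← Finset.sum_add_distrib]
  congr 1
  refine Finset.sum_congr rfl fun i hi => ?_
  have hai : a ≠ i := fun h => ha (h ▸ hi)
  rw [hgeom i hi, Finset.erase_insert_of_ne hai,
    Finset.prod_insert fun h => ha (Finset.mem_of_mem_erase h)]
  have h1 := sub_ne_zero.2 (hne i hi)
  have h2 := sub_ne_zero.2 (hne i hi).symm
  rw [← neg_sub (x a), div_neg]
  field_simp
  ring

end Field

/-- For `n ≥ 2`, `k ≥ 1`:
`G_{n,k} = q·G_{n-1,k} + (q - q⁻¹)·∑_{i=0}^{k-1} L_n^{k-i}·G_{n-1,i} + q^{-(n-1)}·L_n^k`. -/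
theorem stmt_3 (n k : ℕ) (hn : 2 ≤ n) (hk : 1 ≤ k) :
    G n Finset.univ k =
      qq n * G n (pset n (n - 1)) k
        + (qq n - (qq n)⁻¹) *
            ∑ i ∈ Finset.range k, (L n ⟨n - 1, by omega⟩) ^ (k - i) * G n (pset n (n - 1)) i
        + (qq n) ^ (-((n : ℤ) - 1)) * (L n ⟨n - 1, by omega⟩) ^ k := by
  have ha : (⟨n - 1, by omega⟩ : Fin n) ∉ pset n (n - 1) := by simp [pset]
  have hins : insert (⟨n - 1, by omega⟩ : Fin n) (pset n (n - 1)) = Finset.univ := by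
    ext j
    simp only [pset, Finset.mem_insert, Finset.mem_filter, Finset.mem_univ, true_and, iff_true,
      Fin.ext_iff]
    omega
  have hcard : (pset n (n - 1)).card = n - 1 := by
    have h := Finset.card_insert_of_notMem ha
    rw [hins, Finset.card_univ, Fintype.card_fin] at h
    omega
  have hpow : (qq n) ^ (-((n : ℤ) - 1)) = (qq n)⁻¹ ^ (n - 1) := by
    rw [show (n : ℤ) - 1 = ((n - 1 : ℕ) : ℤ) by omega, zpow_neg, zpow_natCast, inv_pow]
  have h := sum_insert_pow_mul_prod_div_sub _ _ ha (L n) (L_injective n)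
    (fun i _ => L_ne_zero n i) (qq n) (qq n)⁻¹ k
  rw [hins, hcard] at h
  rw [hpow]
  exact h
end
end

section
/- For all integers n ≥ 2 and k ≥ 0, the element G_{n,k} of F is a polynomial in L_1,…,L_n; that is, G_{n,k} lies in the image of the canonical embedding of K[L_1,…,L_n] into its fraction field F. -/
open scoped BigOperators

noncomputable section

open Polynomial in
/-- The top divided difference of a polynomial over `R` at nodes in `R` lies in `R`. -/
theorem sum_eval_div_prod_sub_mem_range {R F ι : Type*} [CommRing R] [Field F] [Algebra R F]
    [FaithfulSMul R F] [DecidableEq ι] (s : Finset ι) (v : ι → R) (hv : Set.InjOn v s)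
    (p : R[X]) :
    ∑ i ∈ s, algebraMap R F (p.eval (v i)) /
      ∏ j ∈ s.erase i, (algebraMap R F (v i) - algebraMap R F (v j)) ∈
        Set.range (algebraMap R F) := by
  have hinj := FaithfulSMul.algebraMap_injective R F
  have : Nontrivial R := (algebraMap R F).domain_nontrivial
  set r := p %ₘ Lagrange.nodal s v with hr
  have hdeg : (r.map (algebraMap R F)).degree < s.card :=
    degree_map_le.trans_lt <|
      (degree_modByMonic_lt p Lagrange.nodal_monic).trans_eq Lagrange.degree_nodal
  have heval : ∀ i ∈ s, r.eval (v i) = p.eval (v i) := fun i hi ↦ by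
    conv_rhs => rw [← modByMonic_add_div p (Lagrange.nodal s v)]
    simp [Lagrange.eval_nodal_at_node hi, hr]
  have hv' : Set.InjOn (fun i ↦ algebraMap R F (v i)) s := hinj.comp_injOn hv
  refine ⟨r.coeff (s.card - 1), ?_⟩
  rw [← coeff_map, Lagrange.coeff_eq_sum hv' hdeg]
  refine Finset.sum_congr rfl fun i hi ↦ ?_
  rw [eval_map_algebraMap, aeval_algebraMap_apply, coe_aeval_eq_eval, heval i hi]

open Polynomial in
/-- If `a - b` is a unit, the products `∏ j ≠ i, (a * v i - b * v j)` are the values at the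
nodes `v i` of a single polynomial. -/
theorem exists_eval_eq_prod_erase_mul_sub_mul {R ι : Type*} [CommRing R] [IsDomain R]
    [DecidableEq ι] (s : Finset ι) (v : ι → R) (hv : ∀ i ∈ s, v i ≠ 0) {a b : R}
    (hab : IsUnit (a - b)) :
    ∃ g : R[X], ∀ i ∈ s, g.eval (v i) = ∏ j ∈ s.erase i, (a * v i - b * v j) := by
  obtain ⟨c, hc⟩ := hab.exists_left_inv
  obtain ⟨g, hg⟩ : X ∣ ∏ j ∈ s, (C a * X - C (b * v j)) - C (b ^ s.card) * Lagrange.nodal s v := by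
    rw [X_dvd_iff, coeff_zero_eq_eval_zero]
    simp [eval_prod, Lagrange.eval_nodal, ← Finset.prod_const, ← Finset.prod_mul_distrib]
  refine ⟨C c * g, fun i hi ↦ mul_left_cancel₀ (hv i hi) ?_⟩
  have h := congrArg (eval (v i)) hg
  simp only [eval_sub, eval_mul, eval_prod, eval_C, eval_X, Lagrange.eval_nodal_at_node hi,
    mul_zero, sub_zero, ← Finset.mul_prod_erase s _ hi] at h
  rw [eval_mul, eval_C]
  linear_combination
    (-c) * h + v i * (∏ j ∈ s.erase i, (a * v i - b * v j)) * hc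

theorem isUnit_ratFuncX_sub_inv : IsUnit (RatFunc.X - RatFunc.X⁻¹ : Kq) := by
  have hX : (RatFunc.X : Kq) ≠ 0 := RatFunc.X_ne_zero
  refine isUnit_iff_ne_zero.mpr fun h ↦ ?_
  have h2 : (RatFunc.X : Kq) ^ 2 = 1 := by
    field_simp at h
    linear_combination h
  have h3 : (Polynomial.X : Polynomial ℚ) ^ 2 = 1 :=
    RatFunc.algebraMap_injective ℚ (by simpa using h2)
  simpa using congrArg Polynomial.natDegree h3

theorem inv_qq (n : ℕ) :
    (qq n)⁻¹ = algebraMap (Pn n) (Fn n) (MvPolynomial.C RatFunc.X⁻¹) := by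
  refine inv_eq_of_mul_eq_one_right ?_
  rw [qq, ← map_mul, ← map_mul, mul_inv_cancel₀ RatFunc.X_ne_zero, map_one, map_one]

/-- For `n ≥ 2` and `k ≥ 0`, `G_{n,k}` is a polynomial in the `L_i`'s, i.e. it lies
in the image of the canonical embedding of `K[L_1,…,L_n]` into its fraction field. -/
theorem stmt_4 (n k : ℕ) (hn : 2 ≤ n) :
    G n Finset.univ k ∈ Set.range (algebraMap (Pn n) (Fn n)) := by
  obtain ⟨g, hg⟩ := exists_eval_eq_prod_erase_mul_sub_mul (R := Pn n) Finset.univ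
    MvPolynomial.X (fun i _ ↦ MvPolynomial.X_ne_zero i)
    (a := MvPolynomial.C RatFunc.X) (b := MvPolynomial.C RatFunc.X⁻¹)
    (by simpa using isUnit_ratFuncX_sub_inv.map (MvPolynomial.C (σ := Fin n)))
  convert sum_eval_div_prod_sub_mem_range (F := Fn n) Finset.univ
    (MvPolynomial.X : Fin n → Pn n) (MvPolynomial.X_injective.injOn)
    (Polynomial.X ^ k * g) using 1
  refine Finset.sum_congr rfl fun i hi ↦ ?_
  rw [P, Finset.prod_div_distrib, ← mul_div_assoc, Polynomial.eval_mul, hg i hi, inv_qq]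
  simp [L, qq]
end
end

section
/- For every integer n ≥ 2, writing S' = {1,…,n}∖{n−1}, the following identity holds in F: G_{n,0} = (q·G_{n−1,1} − q^{−1}·L_n·G_{n−1,0})/(L_{n−1} − L_n) − (q·G_{S',1} − q^{−1}·L_{n−1}·G_{S',0})/(L_{n−1} − L_n). -/
open scoped BigOperators

noncomputable section

theorem P_erase {n : ℕ} {S : Finset (Fin n)} {i b : Fin n} (hb : b ∈ S) (hib : i ≠ b) :
    (qq n * L n i - (qq n)⁻¹ * L n b) * P n (S.erase b) i = (L n i - L n b) * P n S i := by
  have h : L n i - L n b ≠ 0 := sub_ne_zero.mpr ((L_injective n).ne hib)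
  unfold P
  rw [← Finset.mul_prod_erase (S.erase i) _ (Finset.mem_erase.mpr ⟨hib.symm, hb⟩),
    Finset.erase_right_comm, ← mul_assoc, mul_div_cancel₀ _ h]

theorem G_erase {n : ℕ} {S : Finset (Fin n)} {b : Fin n} (hb : b ∈ S) :
    qq n * G n (S.erase b) 1 - (qq n)⁻¹ * L n b * G n (S.erase b) 0 =
      ∑ i ∈ S, (L n i - L n b) * P n S i := by
  rw [← Finset.add_sum_erase S _ hb, sub_self, zero_mul, zero_add]
  unfold G
  rw [Finset.mul_sum, Finset.mul_sum, ← Finset.sum_sub_distrib]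
  refine Finset.sum_congr rfl fun i hi => ?_
  rw [← P_erase hb (Finset.ne_of_mem_erase hi)]
  ring

theorem pset_pred {n : ℕ} (hn : n - 1 < n) :
    pset n (n - 1) = Finset.univ.erase ⟨n - 1, hn⟩ := by
  ext j
  simp only [pset, Finset.mem_filter, Finset.mem_univ, true_and, Finset.mem_erase, and_true,
    ne_eq, Fin.ext_iff]
  omega

/-- For `n ≥ 2`, with `S' = {1,…,n} \ {n-1}` (removing the variable `L_{n-1}`):
`G_{n,0} = (q·G_{n-1,1} - q⁻¹·L_n·G_{n-1,0})/(L_{n-1} - L_n)`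
`        - (q·G_{S',1} - q⁻¹·L_{n-1}·G_{S',0})/(L_{n-1} - L_n)`. -/
theorem stmt_6 (n : ℕ) (hn : 2 ≤ n) :
    G n Finset.univ 0 =
      (qq n * G n (pset n (n - 1)) 1
          - (qq n)⁻¹ * L n ⟨n - 1, by omega⟩ * G n (pset n (n - 1)) 0) /
        (L n ⟨n - 2, by omega⟩ - L n ⟨n - 1, by omega⟩)
      - (qq n * G n (Finset.univ.erase ⟨n - 2, by omega⟩) 1
          - (qq n)⁻¹ * L n ⟨n - 2, by omega⟩ * G n (Finset.univ.erase ⟨n - 2, by omega⟩) 0) /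
        (L n ⟨n - 2, by omega⟩ - L n ⟨n - 1, by omega⟩) := by
  have hne : L n ⟨n - 2, by omega⟩ - L n ⟨n - 1, by omega⟩ ≠ 0 := by
    refine sub_ne_zero.mpr ((L_injective n).ne ?_)
    simp only [ne_eq, Fin.mk.injEq]
    omega
  rw [pset_pred (by omega), G_erase (Finset.mem_univ _), G_erase (Finset.mem_univ _),
    ← sub_div, eq_div_iff hne, ← Finset.sum_sub_distrib, G, Finset.sum_mul]
  exact Finset.sum_congr rfl fun i _ => by ring
end
end

section
/- For every integer n ≥ 2, the K-subalgebra of F generated by the n elements G_{n,1}, G_{n,2}, …, G_{n,n} is equal to the image in F of the subalgebra of K[L_1,…,L_n] consisting of all symmetric polynomials (i.e., the polynomials invariant under every permutation of the variables L_1,…,L_n). -/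
open scoped BigOperators

noncomputable section

open Polynomial in
theorem coeff_of_eq_X_sub_C_mul {R : Type*} [CommRing R] {g h : R[X]} {x : R} {n : ℕ}
    (hg : g = (X - C x) * h) (hh : h.natDegree < n) {k : ℕ} (hk : k ≤ n) :
    h.coeff (n - k) = ∑ b ∈ Finset.range k, g.coeff (n - b) * x ^ (k - 1 - b) := by
  induction k with
  | zero => simpa using coeff_eq_zero_of_natDegree_lt hh
  | succ k ih =>
    have hrec : g.coeff (n - k) = h.coeff (n - (k + 1)) - x * h.coeff (n - k) := by
      obtain ⟨m, rfl⟩ := Nat.exists_eq_add_of_le hk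
      rw [show k + 1 + m - k = m + 1 by lia, show k + 1 + m - (k + 1) = m by lia, hg, sub_mul,
        coeff_sub, coeff_X_mul, coeff_C_mul]
    rw [Finset.sum_range_succ, eq_add_of_sub_eq hrec.symm, ih (by lia), Finset.mul_sum, add_comm]
    congr 1
    · refine Finset.sum_congr rfl fun b hb => ?_
      have := Finset.mem_range.1 hb
      rw [show k + 1 - 1 - b = k - 1 - b + 1 by lia, pow_succ]
      ring
    · simp

open Polynomial in
theorem coeff_prod_X_sub_C {R S ι : Type*} [CommRing R] [CommRing S] [Algebra R S] [Fintype ι]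
    (x : ι → S) {k : ℕ} (hk : k ≤ Fintype.card ι) :
    (∏ j, (X - C (x j))).coeff (Fintype.card ι - k) =
      (-1) ^ k * MvPolynomial.aeval x (MvPolynomial.esymm ι R k) := by
  have := Multiset.prod_X_sub_C_coeff (Finset.univ.val.map x) (k := Fintype.card ι - k) (by simp)
  rw [MvPolynomial.aeval_esymm_eq_multiset_esymm]
  simpa [Nat.sub_sub_self hk] using this

open Polynomial in
theorem coeff_prod_X_sub_C_mul {R ι : Type*} [CommRing R] [Fintype ι] (x : ι → R) (t : R)
    {k : ℕ} (hk : k ≤ Fintype.card ι) :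
    (∏ j, (X - C (t * x j))).coeff (Fintype.card ι - k) =
      t ^ k * (∏ j, (X - C (x j))).coeff (Fintype.card ι - k) := by
  rw [coeff_prod_X_sub_C (R := R) _ hk, coeff_prod_X_sub_C (R := R) _ hk,
    MvPolynomial.aeval_esymm_eq_multiset_esymm, MvPolynomial.aeval_esymm_eq_multiset_esymm]
  have := Multiset.pow_smul_esymm t k (Finset.univ.val.map x)
  simp only [smul_eq_mul, Multiset.map_map, Function.comp_def] at this
  rw [← this]
  ring

open Polynomial in
/-- The Newton-type identity for Hall–Littlewood functions of one row. -/
theorem pow_sub_one_mul_coeff_prod_X_sub_C {F ι : Type*} [Field F] [Fintype ι] [DecidableEq ι]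
    {x : ι → F} (hx : Function.Injective x) (t : F) {k : ℕ} (hk : 1 ≤ k)
    (hkn : k ≤ Fintype.card ι) :
    (t ^ k - 1) * (∏ j, (X - C (x j))).coeff (Fintype.card ι - k) =
      ∑ b ∈ Finset.range k, (∏ j, (X - C (x j))).coeff (Fintype.card ι - b) *
        ((1 - t) * ∑ i, x i ^ (k - b) *
          ∏ j ∈ Finset.univ.erase i, (x i - t * x j) / (x i - x j)) := by
  set n := Fintype.card ι
  set g : F[X] := ∏ j, (X - C (x j))
  let h (i : ι) : F[X] := ∏ j ∈ Finset.univ.erase i, (X - C (x j))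
  have hgh (i : ι) : g = (X - C (x i)) * h i := (Finset.mul_prod_erase _ _ (Finset.mem_univ i)).symm
  have hdeg (i : ι) : (h i).natDegree < n := by
    rw [natDegree_prod_of_monic _ _ fun j _ => monic_X_sub_C _]
    have : 0 < Fintype.card ι := Fintype.card_pos_iff.2 ⟨i⟩
    simp only [natDegree_X_sub_C, Finset.sum_const, Finset.card_erase_of_mem (Finset.mem_univ i),
      Finset.card_univ, smul_eq_mul, mul_one]
    lia
  let f : F[X] := ∏ j, (X - C (t * x j)) - g
  have hf : f = ∑ i, C ((1 - t) * x i *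
      ∏ j ∈ Finset.univ.erase i, (x i - t * x j) / (x i - x j)) * h i := by
    have hfdeg : f.degree < (Finset.univ : Finset ι).card := by
      have hdegree (y : ι → F) : (∏ j, (X - C (y j))).degree =
          ((Finset.univ : Finset ι).card : WithBot ℕ) := by
        simp [degree_prod]
      refine (degree_sub_lt_left ((hdegree _).trans (hdegree _).symm)
        (monic_prod_of_monic _ _ fun j _ => monic_X_sub_C _).ne_zero ?_).trans_eq (hdegree _)
      rw [(monic_prod_of_monic _ _ fun j _ => monic_X_sub_C _).leadingCoeff,
        (monic_prod_of_monic _ _ fun j _ => monic_X_sub_C _).leadingCoeff]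
    rw [Lagrange.eq_interpolate (s := Finset.univ) hx.injOn hfdeg, Lagrange.interpolate_apply]
    refine Finset.sum_congr rfl fun i _ => ?_
    have hev : f.eval (x i) = (1 - t) * x i * ∏ j ∈ Finset.univ.erase i, (x i - t * x j) := by
      have : eval (x i) g = 0 := by rw [hgh i]; simp
      simp only [f, eval_sub, this, eval_prod, eval_X, eval_C, sub_zero]
      rw [← Finset.mul_prod_erase _ _ (Finset.mem_univ i)]
      ring
    rw [hev, Lagrange.basis]
    simp only [Lagrange.basisDivisor, Finset.prod_mul_distrib, div_eq_mul_inv, h, C_mul, map_prod]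
    ring
  have hfc : f.coeff (n - k) = (t ^ k - 1) * g.coeff (n - k) := by
    rw [coeff_sub, coeff_prod_X_sub_C_mul x t hkn]
    ring
  rw [← hfc, hf, finsetSum_coeff]
  simp only [coeff_C_mul, coeff_of_eq_X_sub_C_mul (hgh _) (hdeg _) hkn, Finset.mul_sum]
  rw [Finset.sum_comm]
  refine Finset.sum_congr rfl fun b hb => Finset.sum_congr rfl fun i _ => ?_
  have := Finset.mem_range.1 hb
  rw [show k - b = k - 1 - b + 1 by lia, pow_succ]
  ring

/-- Two sequences linked by a triangular recursion with invertible leading scalars generate the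
same subalgebra. -/
theorem adjoin_eq_adjoin_of_triangular {K A : Type*} [Field K] [CommRing A] [Algebra K A]
    {n : ℕ} {c G : ℕ → A} {u : ℕ → K} {v : ℕ → K} (hv : v 0 ≠ 0)
    (hu : ∀ k, 1 ≤ k → u k ≠ 0) (h0 : c 0 = 1)
    (h : ∀ k, 1 ≤ k → k ≤ n → u k • c k = ∑ b ∈ Finset.range k, c b * v b • G (k - b)) :
    Algebra.adjoin K (G '' Set.Icc 1 n) = Algebra.adjoin K (c '' Set.Icc 1 n) := by
  apply le_antisymm <;> rw [Algebra.adjoin_le_iff] <;> rintro _ ⟨k, hk, rfl⟩ <;>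
    rw [SetLike.mem_coe]
  · induction k using Nat.strong_induction_on with
    | _ k ih =>
      obtain ⟨hk1, hkn⟩ := hk
      have hc (b : ℕ) (hb : b ≤ n) : c b ∈ Algebra.adjoin K (c '' Set.Icc 1 n) := by
        obtain rfl | hb0 := Nat.eq_zero_or_pos b
        · rw [h0]; exact one_mem _
        · exact Algebra.subset_adjoin ⟨b, ⟨hb0, hb⟩, rfl⟩
      have hk := h k hk1 hkn
      obtain ⟨m, rfl⟩ : ∃ m, k = m + 1 := ⟨k - 1, by lia⟩
      rw [Finset.sum_range_succ', h0, one_mul, Nat.sub_zero] at hk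
      have hG : G (m + 1) = (v 0)⁻¹ • (u (m + 1) • c (m + 1) -
          ∑ b ∈ Finset.range m, c (b + 1) * v (b + 1) • G (m + 1 - (b + 1))) := by
        rw [hk, add_sub_cancel_left, inv_smul_smul₀ hv]
      rw [hG]
      refine Subalgebra.smul_mem _ (sub_mem (Subalgebra.smul_mem _ (hc _ hkn) _)
        (sum_mem fun b hb => mul_mem (hc _ ?_) (Subalgebra.smul_mem _ (ih _ ?_ ?_) _))) _
      all_goals have := Finset.mem_range.1 hb
      · lia
      · lia
      · constructor <;> lia
  · induction k using Nat.strong_induction_on with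
    | _ k ih =>
      obtain ⟨hk1, hkn⟩ := hk
      rw [← inv_smul_smul₀ (hu k hk1) (c k), h k hk1 hkn]
      refine Subalgebra.smul_mem _ (sum_mem fun b hb => mul_mem ?_ (Subalgebra.smul_mem _
        (Algebra.subset_adjoin (Set.mem_image_of_mem G ?_)) _)) _
      all_goals have := Finset.mem_range.1 hb
      · obtain rfl | hb0 := Nat.eq_zero_or_pos b
        · rw [h0]; exact one_mem _
        · exact ih b this ⟨hb0, by lia⟩
      · constructor <;> lia

theorem symmetricSubalgebra_eq_adjoin_esymm (R : Type*) [CommRing R] (n : ℕ) :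
    MvPolynomial.symmetricSubalgebra (Fin n) R =
      Algebra.adjoin R (MvPolynomial.esymm (Fin n) R '' Set.Icc 1 n) := by
  apply le_antisymm
  · intro p hp
    obtain ⟨r, hr⟩ := MvPolynomial.esymmAlgHom_surjective (σ := Fin n) (n := n) R (by simp) ⟨p, hp⟩
    have hr' := congrArg Subtype.val hr
    rw [MvPolynomial.esymmAlgHom_apply] at hr'
    have hmem : p ∈ Algebra.adjoin R
        (Set.range fun i : Fin n => MvPolynomial.esymm (Fin n) R (i + 1)) := by
      rw [Algebra.adjoin_range_eq_range_aeval]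
      exact ⟨r, hr'⟩
    refine Algebra.adjoin_mono ?_ hmem
    rintro _ ⟨i, rfl⟩
    exact ⟨i + 1, ⟨by lia, by lia⟩, rfl⟩
  · rw [Algebra.adjoin_le_iff]
    rintro _ ⟨k, -, rfl⟩
    exact MvPolynomial.esymm_isSymmetric _ _ k

theorem RatFunc.X_pow_ne_one {R : Type*} [CommRing R] [IsDomain R] {k : ℕ} (hk : k ≠ 0) :
    (RatFunc.X : RatFunc R) ^ k ≠ 1 := by
  rw [← RatFunc.algebraMap_X, ← map_pow, ← map_one (algebraMap (Polynomial R) (RatFunc R))]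
  intro h
  have := congrArg Polynomial.natDegree (RatFunc.algebraMap_injective R h)
  simp [hk] at this

theorem algebraMap_X_eq_qq (n : ℕ) : algebraMap Kq (Fn n) RatFunc.X = qq n := by
  rw [IsScalarTower.algebraMap_apply Kq (Pn n) (Fn n)]
  rfl

theorem P_univ_eq (n : ℕ) (i : Fin n) :
    P n Finset.univ i = qq n ^ (n - 1) *
      ∏ j ∈ Finset.univ.erase i, (L n i - (qq n)⁻¹ ^ 2 * L n j) / (L n i - L n j) := by
  have hcard : (Finset.univ.erase i).card = n - 1 := by simp
  rw [P, ← hcard, ← Finset.prod_const, ← Finset.prod_mul_distrib]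
  refine Finset.prod_congr rfl fun j _ => ?_
  have := qq_ne_zero n
  rw [mul_div_assoc']
  congr 1
  field_simp

/-- For `n ≥ 2`, the `K`-subalgebra of `F` generated by `G_{n,1}, …, G_{n,n}` equals the
image in `F` of the subalgebra of symmetric polynomials of `K[L_1,…,L_n]`. -/
theorem stmt_10 (n : ℕ) (hn : 2 ≤ n) :
    Algebra.adjoin Kq {x : Fn n | ∃ j ∈ Finset.Icc 1 n, x = G n Finset.univ j} =
      (MvPolynomial.symmetricSubalgebra (Fin n) Kq).map
        (IsScalarTower.toAlgHom Kq (Pn n) (Fn n)) := by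
  let t : Kq := RatFunc.X⁻¹ ^ 2
  let s : Kq := (1 - t) * (RatFunc.X ^ (n - 1))⁻¹
  let e (k : ℕ) : Fn n := IsScalarTower.toAlgHom Kq (Pn n) (Fn n) (MvPolynomial.esymm (Fin n) Kq k)
  have hX : (RatFunc.X : Kq) ≠ 0 := RatFunc.X_ne_zero
  have hu (k : ℕ) (hk : 1 ≤ k) : t ^ k - 1 ≠ 0 := by
    rw [sub_ne_zero, ← pow_mul, inv_pow, ne_eq, inv_eq_one]
    exact RatFunc.X_pow_ne_one (by lia)
  have hs : s ≠ 0 := by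
    refine mul_ne_zero ?_ (inv_ne_zero (pow_ne_zero _ hX))
    rw [← neg_sub, neg_ne_zero]
    simpa using hu 1 le_rfl
  have ht : algebraMap Kq (Fn n) t = (qq n)⁻¹ ^ 2 := by
    simp only [t, map_pow, map_inv₀, algebraMap_X_eq_qq]
  have hsG (k : ℕ) : s • G n Finset.univ k = (1 - (qq n)⁻¹ ^ 2) * ∑ i, L n i ^ k *
      ∏ j ∈ Finset.univ.erase i, (L n i - (qq n)⁻¹ ^ 2 * L n j) / (L n i - L n j) := by
    have hq := pow_ne_zero (n - 1) (qq_ne_zero n)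
    simp only [Algebra.smul_def, s, map_mul, map_sub, map_one, ht, map_inv₀, map_pow,
      algebraMap_X_eq_qq, G, P_univ_eq]
    rw [mul_assoc, Finset.mul_sum]
    congr 1
    refine Finset.sum_congr rfl fun i _ => ?_
    rw [mul_left_comm, inv_mul_cancel_left₀ hq]
  have hc (k : ℕ) (hk : k ≤ n) : (∏ j, (Polynomial.X - Polynomial.C (L n j))).coeff (n - k) =
      (-1) ^ k * e k := by
    have haeval : MvPolynomial.aeval (R := Kq) (L n) = IsScalarTower.toAlgHom Kq (Pn n) (Fn n) :=
      MvPolynomial.algHom_ext fun i => by simp [L]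
    have := coeff_prod_X_sub_C (R := Kq) (L n) (k := k) (by simpa using hk)
    rwa [haeval, Fintype.card_fin] at this
  have hrec (k : ℕ) (hk : 1 ≤ k) (hkn : k ≤ n) : ((t ^ k - 1) * (-1) ^ k) • e k =
      ∑ b ∈ Finset.range k, e b * ((-1) ^ b * s) • G n Finset.univ (k - b) := by
    have := pow_sub_one_mul_coeff_prod_X_sub_C (L_injective n) ((qq n)⁻¹ ^ 2) hk
      (by simpa using hkn)
    rw [Fintype.card_fin, hc k hkn] at this
    simp only [Algebra.smul_def (_ * _), map_mul, map_sub, map_pow, map_neg, map_one, ht]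
    rw [mul_assoc, this]
    refine Finset.sum_congr rfl fun b hb => ?_
    rw [hc b (by have := Finset.mem_range.1 hb; lia), ← hsG, Algebra.smul_def]
    ring
  have hset : {x : Fn n | ∃ j ∈ Finset.Icc 1 n, x = G n Finset.univ j} =
      G n Finset.univ '' Set.Icc 1 n := by
    ext x
    simp [eq_comm]
  rw [hset, symmetricSubalgebra_eq_adjoin_esymm, AlgHom.map_adjoin, ← Set.image_comp]
  refine adjoin_eq_adjoin_of_triangular (v := fun b => (-1) ^ b * s) (by simpa using hs)
    (fun k hk => mul_ne_zero (hu k hk) (by simp)) ?_ hrec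
  simp
end
end
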